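/- arXiv:math/0111314 — 4 statements merged into one kernel-verified Lean document; each statement's English description precedes it below -/
import Mathlib

section
/- If a ≤ r−2 (equivalently, if G is not contained in SL(2,ℂ)), then the constant polynomial 1 lies in S_0 = S_{(a+1)−(a+1)} but does not lie in the ℂ-linear span of {f·h : f ∈ S_{−(a+1)}, h ∈ S_{a+1}}; consequently the map Φ_{a+1} is not surjective (the representation ρ_{a+1} is not special). -/
/-- The `G`-basis `B(G)` for the cyclic group `C_{r,a}`: monomials `x^m y^n`
(identified with pairs `(m,n) ∈ ℕ × ℕ`) that are divisible by no nonconstant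
`G`-invariant monomial, where `x^p y^q` is `G`-invariant iff `r ∣ p + a*q`. -/
def BG (r a : ℕ) : Set (ℕ × ℕ) :=
  {mn | ∀ p q : ℕ, (p, q) ≠ (0, 0) → r ∣ p + a * q → ¬(p ≤ mn.1 ∧ q ≤ mn.2)}

/-- The `L`-space `L(G)`: the monomials `x^k` and `y^k` with `0 ≤ k ≤ r-1`. -/
def LG (r : ℕ) : Set (ℕ × ℕ) :=
  {mn | (mn.2 = 0 ∧ mn.1 ≤ r - 1) ∨ (mn.1 = 0 ∧ mn.2 ≤ r - 1)}

open MvPolynomial in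
/-- The `ℂ`-algebra automorphism `g` of `ℂ[x,y]` with `g x = ε • x`, `g y = ε^a • y`. -/
noncomputable def gAut (ε : ℂ) (a : ℕ) :
    MvPolynomial (Fin 2) ℂ →ₐ[ℂ] MvPolynomial (Fin 2) ℂ :=
  aeval (fun j : Fin 2 => if j = 0 then C ε * X 0 else C (ε ^ a) * X 1)

/-- The semi-invariants of weight `i`: `S_i = {f : g f = ε^i • f}`. -/
def Sset (ε : ℂ) (a : ℕ) (i : ℤ) : Set (MvPolynomial (Fin 2) ℂ) :=
  {f | gAut ε a f = (ε ^ i) • f}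

/-- Surjectivity of the multiplication map `Φ_i : S_{-(a+1)} × S_i → S_{i-(a+1)}`:
`S_{i-(a+1)}` equals the `ℂ`-linear span of the products `f * h`. -/
def PhiSurj (ε : ℂ) (a : ℕ) (i : ℤ) : Prop :=
  Sset ε a (i - (a + 1)) =
    ↑(Submodule.span ℂ
      {p : MvPolynomial (Fin 2) ℂ |
        ∃ f ∈ Sset ε a (-(a + 1)), ∃ h ∈ Sset ε a i, p = f * h})

/-- The automorphism `g` fixes constant terms. -/
theorem constantCoeff_gAut (ε : ℂ) (a : ℕ) (f : MvPolynomial (Fin 2) ℂ) :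
    MvPolynomial.constantCoeff (gAut ε a f) = MvPolynomial.constantCoeff f := by
  induction f using MvPolynomial.induction_on with
  | C c => simp [gAut]
  | add p q hp hq => simp only [map_add, hp, hq]
  | mul_X p j hp =>
    have hX : MvPolynomial.constantCoeff (gAut ε a (MvPolynomial.X j)) = 0 := by
      rw [gAut, MvPolynomial.aeval_X]
      split_ifs <;> simp
    rw [map_mul, map_mul, hX, map_mul, MvPolynomial.constantCoeff_X, mul_zero, mul_zero]

/-- A semi-invariant whose character is nontrivial has no constant term. -/
theorem constantCoeff_eq_zero_of_mem_Sset {ε : ℂ} {a : ℕ} {i : ℤ} (hi : ε ^ i ≠ 1)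
    {f : MvPolynomial (Fin 2) ℂ} (hf : f ∈ Sset ε a i) :
    MvPolynomial.constantCoeff f = 0 := by
  have h := congrArg MvPolynomial.constantCoeff (show gAut ε a f = ε ^ i • f from hf)
  rw [constantCoeff_gAut, MvPolynomial.constantCoeff_smul, smul_eq_mul] at h
  exact (mul_eq_zero.mp (show (ε ^ i - 1) * MvPolynomial.constantCoeff f = 0 by
    rw [sub_mul, one_mul, ← h, sub_self])).resolve_left (sub_ne_zero.mpr hi)

/-- Linear combinations of products whose first factor is a semi-invariant with nontrivial
character have no constant term. -/
theorem constantCoeff_eq_zero_of_mem_span_mul {ε : ℂ} {a : ℕ} {i j : ℤ} (hi : ε ^ i ≠ 1)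
    {p : MvPolynomial (Fin 2) ℂ}
    (hp : p ∈ Submodule.span ℂ
      {p : MvPolynomial (Fin 2) ℂ | ∃ f ∈ Sset ε a i, ∃ h ∈ Sset ε a j, p = f * h}) :
    MvPolynomial.constantCoeff p = 0 := by
  induction hp using Submodule.span_induction with
  | mem p hp =>
    obtain ⟨f, hf, h, -, rfl⟩ := hp
    rw [map_mul, constantCoeff_eq_zero_of_mem_Sset hi hf, zero_mul]
  | zero => exact map_zero _
  | add p q _ _ hp hq => rw [map_add, hp, hq, add_zero]
  | smul c p _ hp => rw [MvPolynomial.constantCoeff_smul, hp, smul_zero]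

/-- if `a ≤ r-2`, then `1 ∈ S_{(a+1)-(a+1)}` but `1` is not in the span of
the products `f * h` with `f ∈ S_{-(a+1)}`, `h ∈ S_{a+1}`; hence `Φ_{a+1}` is not
surjective. -/
theorem stmt_6 (r a : ℕ) (hr : 2 ≤ r) (ha1 : 1 ≤ a) (ha2 : a ≤ r - 1)
    (hgcd : Nat.Coprime a r) (ε : ℂ) (hε : IsPrimitiveRoot ε r)
    (ha : a ≤ r - 2) :
    (1 : MvPolynomial (Fin 2) ℂ) ∈ Sset ε a (((a : ℤ) + 1) - ((a : ℤ) + 1)) ∧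
      (1 : MvPolynomial (Fin 2) ℂ) ∉
        Submodule.span ℂ
          {p : MvPolynomial (Fin 2) ℂ |
            ∃ f ∈ Sset ε a (-((a : ℤ) + 1)), ∃ h ∈ Sset ε a ((a : ℤ) + 1), p = f * h} ∧
      ¬ PhiSurj ε a ((a : ℤ) + 1) := by
  have hne : ε ^ (-((a : ℤ) + 1)) ≠ 1 := by
    rw [zpow_neg, ne_eq, inv_eq_one]
    exact_mod_cast hε.pow_ne_one_of_pos_of_lt (Nat.succ_ne_zero a) (by omega)
  have hmem : (1 : MvPolynomial (Fin 2) ℂ) ∈ Sset ε a (((a : ℤ) + 1) - ((a : ℤ) + 1)) := by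
    simp [Sset]
  have hspan : (1 : MvPolynomial (Fin 2) ℂ) ∉
      Submodule.span ℂ
        {p : MvPolynomial (Fin 2) ℂ |
          ∃ f ∈ Sset ε a (-((a : ℤ) + 1)), ∃ h ∈ Sset ε a ((a : ℤ) + 1), p = f * h} :=
    fun h => one_ne_zero
      ((map_one MvPolynomial.constantCoeff).symm.trans
        (constantCoeff_eq_zero_of_mem_span_mul hne h))
  refine ⟨hmem, hspan, fun hsurj => hspan ?_⟩
  rw [PhiSurj] at hsurj
  exact hsurj.subset hmem
end

section
/- Let i be an integer and suppose the monomial x^m y^n belongs to the G-basis B(G) with m ≥ 1, n ≥ 1 and m + a·n ≡ i (mod r). Then the monomial x^(m−1) y^(n−1) lies in S_{i−(a+1)} but does not lie in the ℂ-linear span of {f·h : f ∈ S_{−(a+1)}, h ∈ S_i}; consequently the map Φ_i is not surjective. -/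
open MvPolynomial in
theorem gAut_monomial (ε : ℂ) (a : ℕ) (d : Fin 2 →₀ ℕ) (c : ℂ) :
    gAut ε a (monomial d c) = monomial d (ε ^ (d 0 + a * d 1) * c) := by
  rw [gAut, aeval_monomial, Finsupp.prod_fintype _ _ (by simp), monomial_eq,
    Finsupp.prod_fintype _ _ (by simp)]
  simp only [Fin.prod_univ_two, if_true, one_ne_zero, if_false, algebraMap_eq, map_mul, map_pow]
  ring

open MvPolynomial in
theorem coeff_gAut (ε : ℂ) (a : ℕ) (f : MvPolynomial (Fin 2) ℂ) (d : Fin 2 →₀ ℕ) :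
    coeff d (gAut ε a f) = ε ^ (d 0 + a * d 1) * coeff d f := by
  induction f using MvPolynomial.induction_on' with
  | monomial e c =>
    rw [gAut_monomial, coeff_monomial, coeff_monomial]
    split_ifs with h
    · rw [h]
    · simp
  | add p q hp hq => rw [map_add, coeff_add, coeff_add, hp, hq, mul_add]

open MvPolynomial in
/-- A monomial occurring in a semi-invariant of weight `i` has weight `i` modulo `r`. -/
theorem dvd_weight_sub_of_mem_Sset {r a : ℕ} {ε : ℂ} (hε : IsPrimitiveRoot ε r) {i : ℤ}
    {f : MvPolynomial (Fin 2) ℂ} (hf : f ∈ Sset ε a i) {d : Fin 2 →₀ ℕ} (hd : coeff d f ≠ 0)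
    (hε0 : ε ≠ 0) : (r : ℤ) ∣ ((d 0 + a * d 1 : ℕ) : ℤ) - i := by
  have h : gAut ε a f = (ε ^ i) • f := hf
  have h := congrArg (coeff d) h
  rw [coeff_gAut, coeff_smul, smul_eq_mul] at h
  rw [← hε.zpow_eq_one_iff_dvd, zpow_sub₀ hε0, zpow_natCast, mul_right_cancel₀ hd h,
    div_self (zpow_ne_zero i hε0)]

open MvPolynomial in
theorem X_pow_mul_X_pow_eq_monomial (p q : ℕ) :
    (X 0 ^ p * X 1 ^ q : MvPolynomial (Fin 2) ℂ) =
      monomial (Finsupp.single 0 p + Finsupp.single 1 q) 1 := by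
  rw [X_pow_eq_monomial, X_pow_eq_monomial, monomial_mul, one_mul]

open MvPolynomial in
/-- if `x^m y^n ∈ B(G)` with `m,n ≥ 1` and `m + a·n ≡ i (mod r)`, then
`x^(m-1) y^(n-1)` lies in `S_{i-(a+1)}` but not in the span of the products
`f * h` with `f ∈ S_{-(a+1)}`, `h ∈ S_i`; hence `Φ_i` is not surjective. -/
theorem stmt_7 (r a : ℕ) (hr : 2 ≤ r) (ha1 : 1 ≤ a) (ha2 : a ≤ r - 1)
    (hgcd : Nat.Coprime a r) (ε : ℂ) (hε : IsPrimitiveRoot ε r) (i : ℤ)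
    (m n : ℕ) (hm : 1 ≤ m) (hn : 1 ≤ n) (hB : (m, n) ∈ BG r a)
    (hw : Int.ModEq (r : ℤ) ((m + a * n : ℕ) : ℤ) i) :
    (X 0 ^ (m - 1) * X 1 ^ (n - 1) : MvPolynomial (Fin 2) ℂ) ∈
        Sset ε a (i - (a + 1)) ∧
      (X 0 ^ (m - 1) * X 1 ^ (n - 1) : MvPolynomial (Fin 2) ℂ) ∉
        Submodule.span ℂ
          {p : MvPolynomial (Fin 2) ℂ |
            ∃ f ∈ Sset ε a (-((a : ℤ) + 1)), ∃ h ∈ Sset ε a i, p = f * h} ∧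
      ¬ PhiSurj ε a i := by
  have hε0 : ε ≠ 0 := hε.ne_zero (by omega)
  obtain ⟨p, rfl⟩ : ∃ p, m = p + 1 := ⟨m - 1, by omega⟩
  obtain ⟨q, rfl⟩ : ∃ q, n = q + 1 := ⟨n - 1, by omega⟩
  simp only [Nat.add_sub_cancel]
  have hmem : (X 0 ^ p * X 1 ^ q : MvPolynomial (Fin 2) ℂ) ∈ Sset ε a (i - (a + 1)) := by
    change gAut ε a _ = _
    rw [X_pow_mul_X_pow_eq_monomial, gAut_monomial, smul_monomial, smul_eq_mul]
    congr 2
    rw [← zpow_natCast, ← div_eq_one_iff_eq (zpow_ne_zero _ hε0), ← zpow_sub₀ hε0,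
      hε.zpow_eq_one_iff_dvd]
    have h := hw.symm.dvd
    convert h using 1
    simp
    ring
  have hnot : (X 0 ^ p * X 1 ^ q : MvPolynomial (Fin 2) ℂ) ∉ Submodule.span ℂ
      {p : MvPolynomial (Fin 2) ℂ |
        ∃ f ∈ Sset ε a (-((a : ℤ) + 1)), ∃ h ∈ Sset ε a i, p = f * h} := by
    set e : Fin 2 →₀ ℕ := Finsupp.single 0 p + Finsupp.single 1 q with he
    have hspan : Submodule.span ℂ {p : MvPolynomial (Fin 2) ℂ |
        ∃ f ∈ Sset ε a (-((a : ℤ) + 1)), ∃ h ∈ Sset ε a i, p = f * h} ≤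
        LinearMap.ker (lcoeff ℂ e) := by
      rw [Submodule.span_le]
      rintro _ ⟨f, hf, h, -, rfl⟩
      change coeff e (f * h) = 0
      rw [coeff_mul]
      refine Finset.sum_eq_zero fun x hx => ?_
      rw [Finset.HasAntidiagonal.mem_antidiagonal] at hx
      have hx0 : x.1 0 + x.2 0 = p := by simpa [he] using DFunLike.congr_fun hx 0
      have hx1 : x.1 1 + x.2 1 = q := by simpa [he] using DFunLike.congr_fun hx 1
      by_contra hne
      have hdvd := dvd_weight_sub_of_mem_Sset hε hf (left_ne_zero_of_mul hne) hε0
      refine hB (x.1 0 + 1) (x.1 1 + 1) (by simp) ?_ ⟨by simp; omega, by simp; omega⟩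
      rw [← Int.natCast_dvd_natCast]
      convert hdvd using 1
      push_cast
      ring
    intro hin
    have h0 : coeff e (X 0 ^ p * X 1 ^ q : MvPolynomial (Fin 2) ℂ) = 0 := hspan hin
    rw [X_pow_mul_X_pow_eq_monomial, coeff_monomial, if_pos rfl] at h0
    exact one_ne_zero h0
  exact ⟨hmem, hnot, fun hsurj => hnot (hsurj.subset hmem)⟩
end

section
/- If a = r−1 (the case G = C_{r,r−1} ⊂ SL(2,ℂ)), then the map Φ_i is surjective for every integer i; this recovers, for cyclic groups, the fact that all irreducible representations of a finite subgroup of SL(2,ℂ) are special. -/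
/-- if `a = r-1` (so `G = C_{r,r-1} ⊂ SL(2,ℂ)`), then `Φ_i` is
surjective for every integer `i`. -/
theorem stmt_12 (r a : ℕ) (hr : 2 ≤ r) (ha1 : 1 ≤ a) (ha2 : a ≤ r - 1)
    (hgcd : Nat.Coprime a r) (ε : ℂ) (hε : IsPrimitiveRoot ε r)
    (ha : a = r - 1) :
    ∀ i : ℤ, PhiSurj ε a i := by
  intro i
  have hra : ((a : ℤ) + 1) = (r : ℤ) := by omega
  have hε0 : ε ≠ 0 := hε.ne_zero (by omega)
  have hpow : ε ^ (-((a : ℤ) + 1)) = 1 := by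
    rw [hra, zpow_neg, zpow_natCast, hε.pow_eq_one, inv_one]
  have hshift : ε ^ (i - ((a : ℤ) + 1)) = ε ^ i := by
    rw [sub_eq_add_neg, zpow_add₀ hε0, hpow, mul_one]
  refine Set.Subset.antisymm (fun f hf => ?_) (fun f hf => ?_)
  · refine Submodule.subset_span ⟨1, ?_, f, ?_, (one_mul f).symm⟩
    · simp only [Sset, Set.mem_ofPred_eq, hpow, map_one, one_smul]
    · simpa only [Sset, Set.mem_ofPred_eq, hshift] using hf
  · induction hf using Submodule.span_induction with
    | mem p hp =>
      obtain ⟨f, hf, h, hh, rfl⟩ := hp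
      simp only [Sset, Set.mem_ofPred_eq, hpow, one_smul] at hf hh
      simp only [Sset, Set.mem_ofPred_eq, hshift, map_mul, hf, hh, mul_smul_comm]
    | zero => simp only [Sset, Set.mem_ofPred_eq, map_zero, smul_zero]
    | add p q _ _ hp hq =>
      simp only [Sset, Set.mem_ofPred_eq] at hp hq ⊢
      rw [map_add, hp, hq, smul_add]
    | smul c p _ hp =>
      simp only [Sset, Set.mem_ofPred_eq] at hp ⊢
      rw [map_smul, hp, smul_comm]
end

section
/- (Corollary for A_{r−1}-type singularities.) Suppose a = r−1, and let k be an integer with 1 ≤ k ≤ r. Then the set of monomials not divisible by any of x^k, y^(r+1−k), xy is exactly {x^α : 0 ≤ α ≤ k−1} ∪ {y^β : 1 ≤ β ≤ r−k}; this set has exactly r = |G| elements, and the weight map x^m y^n ↦ (m + a·n mod r) restricts to a bijection from this set onto ℤ/rℤ (so the quotient of ℂ[x,y] by the monomial ideal (x^k, y^(r+1−k), xy) realizes each character of G exactly once, i.e. each such ideal defines a G-cluster). -/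
/-- In `ℤ/rℤ`, the weight `m + (r-1)n` equals `m - n`. -/
theorem weight_eq_intCast_sub (r : ℕ) (hr : 1 ≤ r) (m n : ℕ) :
    ((m + (r - 1) * n : ℕ) : ZMod r) = (((m : ℤ) - n : ℤ) : ZMod r) := by
  push_cast [Nat.cast_sub hr]
  rw [ZMod.natCast_self]
  ring

/-- The weight map is a bijection from the monomials outside `(x^k, y^(r+1-k), xy)` onto
`ℤ/rℤ`. -/
theorem bijOn_weight (r k : ℕ) (hk1 : 1 ≤ k) (hk2 : k ≤ r) :
    Set.BijOn (fun mn : ℕ × ℕ => ((mn.1 + (r - 1) * mn.2 : ℕ) : ZMod r))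
      {mn : ℕ × ℕ | ¬(k ≤ mn.1) ∧ ¬(r + 1 - k ≤ mn.2) ∧ ¬(1 ≤ mn.1 ∧ 1 ≤ mn.2)}
      (Set.univ : Set (ZMod r)) := by
  have hr : 1 ≤ r := hk1.trans hk2
  refine ⟨fun _ _ => Set.mem_univ _, ?_, ?_⟩
  · rintro ⟨m, n⟩ ⟨h1, h2, h3⟩ ⟨m', n'⟩ ⟨h1', h2', h3'⟩ h
    dsimp only at *
    rw [weight_eq_intCast_sub r hr, weight_eq_intCast_sub r hr,
      ZMod.intCast_eq_intCast_iff_dvd_sub] at h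
    have h0 := Int.eq_zero_of_abs_lt_dvd h (abs_lt.2 (by omega))
    exact Prod.ext (by dsimp only; omega) (by dsimp only; omega)
  · intro z _
    have : NeZero r := ⟨by omega⟩
    have hz := ZMod.val_lt z
    by_cases hzk : z.val < k
    · exact ⟨(z.val, 0), by simp; omega, by simp⟩
    · refine ⟨(0, r - z.val), by simp; omega, ?_⟩
      dsimp only
      rw [weight_eq_intCast_sub r hr, Nat.cast_sub hz.le]
      simp

/-- Corollary for `A_{r-1}`-type singularities: for `a = r-1` and
`1 ≤ k ≤ r`, the monomials not divisible by any of `x^k`, `y^(r+1-k)`, `xy` form the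
set `{x^α : α ≤ k-1} ∪ {y^β : 1 ≤ β ≤ r-k}`, which has exactly `r` elements, and the
weight map `x^m y^n ↦ m + a·n mod r` restricts to a bijection from it onto `ℤ/rℤ`. -/
theorem stmt_13 (r a : ℕ) (hr : 2 ≤ r) (ha1 : 1 ≤ a) (ha2 : a ≤ r - 1)
    (hgcd : Nat.Coprime a r) (ha : a = r - 1) (k : ℕ) (hk1 : 1 ≤ k) (hk2 : k ≤ r) :
    {mn : ℕ × ℕ | ¬(k ≤ mn.1) ∧ ¬(r + 1 - k ≤ mn.2) ∧ ¬(1 ≤ mn.1 ∧ 1 ≤ mn.2)} =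
        {mn : ℕ × ℕ | (mn.2 = 0 ∧ mn.1 ≤ k - 1) ∨ (mn.1 = 0 ∧ 1 ≤ mn.2 ∧ mn.2 ≤ r - k)} ∧
      Set.ncard
        {mn : ℕ × ℕ | ¬(k ≤ mn.1) ∧ ¬(r + 1 - k ≤ mn.2) ∧ ¬(1 ≤ mn.1 ∧ 1 ≤ mn.2)} = r ∧
      Set.BijOn (fun mn : ℕ × ℕ => ((mn.1 + a * mn.2 : ℕ) : ZMod r))
        {mn : ℕ × ℕ | ¬(k ≤ mn.1) ∧ ¬(r + 1 - k ≤ mn.2) ∧ ¬(1 ≤ mn.1 ∧ 1 ≤ mn.2)}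
        (Set.univ : Set (ZMod r)) := by
  subst ha
  have hbij := bijOn_weight r k hk1 hk2
  refine ⟨?_, ?_, hbij⟩
  · ext ⟨m, n⟩
    simp only [Set.mem_ofPred_eq]
    omega
  · rw [← hbij.injOn.ncard_image, hbij.image_eq, Set.ncard_univ, Nat.card_zmod]
end
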